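/- Let Σ be a symmetric positive definite d×d real matrix partitioned into N×N blocks and Γ = Σ·D⁻¹ − I_d. Then (1/2)·tr(Γ²) = Σ_{1 ≤ m < n ≤ N} tr( Σ_{mn} · Σ_{nn}⁻¹ · Σ_{nm} · Σ_{mm}⁻¹ ). (This quantity is the variance of the multiinformation density.) -/

import Mathlib

open MeasureTheory Matrix Real

noncomputable section

/-- Index type for a vector partitioned into `N` blocks of sizes `d 0, …, d (N-1)`. -/
abbrev blockIdx {N : ℕ} (d : Fin N → ℕ) : Type := (n : Fin N) × Fin (d n)

/-- The `(m, n)` block of a partitioned matrix. -/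
def blockOf {N : ℕ} (d : Fin N → ℕ) (S : Matrix (blockIdx d) (blockIdx d) ℝ)
    (m n : Fin N) : Matrix (Fin (d m)) (Fin (d n)) ℝ :=
  Matrix.of fun i j => S ⟨m, i⟩ ⟨n, j⟩

/-- The block-diagonal matrix `diag (Σ₁₁, …, Σ_NN)` with the same diagonal blocks as `S`. -/
def blockDiagPart {N : ℕ} (d : Fin N → ℕ) (S : Matrix (blockIdx d) (blockIdx d) ℝ) :
    Matrix (blockIdx d) (blockIdx d) ℝ :=
  Matrix.of fun i j => if i.1 = j.1 then S i j else 0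

lemma blockOf_mul {N : ℕ} (d : Fin N → ℕ) (A B : Matrix (blockIdx d) (blockIdx d) ℝ)
    (m n : Fin N) : blockOf d (A * B) m n = ∑ k, blockOf d A m k * blockOf d B k n := by
  ext i j
  simp [blockOf, Matrix.mul_apply, Matrix.sum_apply, Fintype.sum_sigma]

lemma trace_eq_sum_trace_blockOf {N : ℕ} (d : Fin N → ℕ)
    (A : Matrix (blockIdx d) (blockIdx d) ℝ) : A.trace = ∑ n, (blockOf d A n n).trace := by
  simp [blockOf, Matrix.trace, Fintype.sum_sigma]

lemma blockDiagPart_eq_blockDiagonal' {N : ℕ} (d : Fin N → ℕ)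
    (S : Matrix (blockIdx d) (blockIdx d) ℝ) :
    blockDiagPart d S = Matrix.blockDiagonal' fun n => blockOf d S n n := by
  ext ⟨m, i⟩ ⟨n, j⟩
  by_cases h : m = n
  · subst h
    simp [blockDiagPart, blockOf]
  · simp [blockDiagPart, Matrix.blockDiagonal'_apply_ne _ _ _ h, h]

lemma isUnit_blockOf_self {N : ℕ} (d : Fin N → ℕ) {S : Matrix (blockIdx d) (blockIdx d) ℝ}
    (hS : S.PosDef) (n : Fin N) : IsUnit (blockOf d S n n) :=
  (hS.submatrix (sigma_mk_injective (i := n))).isUnit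

lemma inv_blockDiagPart {N : ℕ} (d : Fin N → ℕ) {S : Matrix (blockIdx d) (blockIdx d) ℝ}
    (hS : S.PosDef) :
    (blockDiagPart d S)⁻¹ = Matrix.blockDiagonal' fun n => (blockOf d S n n)⁻¹ := by
  apply Matrix.inv_eq_right_inv
  rw [blockDiagPart_eq_blockDiagonal', ← Matrix.blockDiagonal'_mul,
    ← Matrix.blockDiagonal'_one]
  congr 1
  funext n
  exact Matrix.mul_nonsing_inv _
    ((Matrix.isUnit_iff_isUnit_det _).1 (isUnit_blockOf_self d hS n))

lemma blockOf_mul_blockDiagonal' {N : ℕ} (d : Fin N → ℕ)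
    (A : Matrix (blockIdx d) (blockIdx d) ℝ) (B : ∀ n, Matrix (Fin (d n)) (Fin (d n)) ℝ)
    (m n : Fin N) :
    blockOf d (A * Matrix.blockDiagonal' B) m n = blockOf d A m n * B n := by
  rw [blockOf_mul, Finset.sum_eq_single n]
  · congr 1
    ext i j
    simp [blockOf]
  · intro k _ hk
    have h : blockOf d (Matrix.blockDiagonal' B) k n = 0 := by
      ext i j
      simp [blockOf, Matrix.blockDiagonal'_apply_ne _ _ _ hk]
    rw [h, Matrix.mul_zero]
  · simp

/-- The blocks of `Γ = Σ·D⁻¹ − I`. -/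
lemma blockOf_mul_inv_blockDiagPart_sub_one {N : ℕ} (d : Fin N → ℕ)
    {S : Matrix (blockIdx d) (blockIdx d) ℝ} (hS : S.PosDef) (m n : Fin N) :
    blockOf d (S * (blockDiagPart d S)⁻¹ - 1) m n =
      if m = n then 0 else blockOf d S m n * (blockOf d S n n)⁻¹ := by
  have hsub : blockOf d (S * (blockDiagPart d S)⁻¹ - 1) m n =
      blockOf d S m n * (blockOf d S n n)⁻¹ - blockOf d 1 m n := by
    rw [inv_blockDiagPart d hS, ← blockOf_mul_blockDiagonal' d S fun n => (blockOf d S n n)⁻¹]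
    rfl
  rw [hsub]
  split_ifs with h
  · subst h
    rw [Matrix.mul_nonsing_inv _
      ((Matrix.isUnit_iff_isUnit_det _).1 (isUnit_blockOf_self d hS m)), sub_eq_zero]
    ext i j
    simp [blockOf, Matrix.one_apply]
  · rw [sub_eq_self]
    ext i j
    simp [blockOf, h]

/-- Half the off-diagonal sum of a symmetric function is its sum over increasing pairs. -/
lemma half_sum_sum_ite_eq_sum_sum_lt {ι : Type*} [Fintype ι] [LinearOrder ι] (f : ι → ι → ℝ)
    (hf : ∀ m n, f m n = f n m) :
    (1 / 2) * ∑ m, ∑ n, (if m = n then 0 else f m n) =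
      ∑ m, ∑ n, if m < n then f m n else 0 := by
  have hsplit : ∑ m, ∑ n, (if m = n then 0 else f m n) =
      (∑ m, ∑ n, if m < n then f m n else 0) + ∑ m, ∑ n, if n < m then f n m else 0 := by
    simp only [← Finset.sum_add_distrib]
    refine Finset.sum_congr rfl fun m _ => Finset.sum_congr rfl fun n _ => ?_
    rcases lt_trichotomy m n with h | h | h
    · simp [h, h.ne, h.not_gt]
    · simp [h]
    · simp [h, h.ne', h.not_gt, hf m n]
  rw [hsplit, Finset.sum_comm (f := fun m n => if n < m then f n m else 0)]
  ring

/-- `½ tr(Γ²) = ∑_{m<n} tr(Σₘₙ Σₙₙ⁻¹ Σₙₘ Σₘₘ⁻¹)`, where `Γ = Σ·D⁻¹ − I`.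
This is the variance of the multiinformation density. -/
theorem variance_multiinformation_density {N : ℕ} (hN : 2 ≤ N) (d : Fin N → ℕ)
    (S : Matrix (blockIdx d) (blockIdx d) ℝ) (hS : S.PosDef) :
    (1 / 2) * (((S * (blockDiagPart d S)⁻¹ - 1) ^ 2).trace) =
      ∑ m : Fin N, ∑ n : Fin N,
        if m < n then
          (blockOf d S m n * (blockOf d S n n)⁻¹ * blockOf d S n m *
            (blockOf d S m m)⁻¹).trace
        else 0 := by
  rw [← half_sum_sum_ite_eq_sum_sum_lt (fun m n => (blockOf d S m n * (blockOf d S n n)⁻¹ *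
    blockOf d S n m * (blockOf d S m m)⁻¹).trace), sq, trace_eq_sum_trace_blockOf]
  · congr 1
    refine Finset.sum_congr rfl fun m _ => ?_
    rw [blockOf_mul, Matrix.trace_sum]
    refine Finset.sum_congr rfl fun n _ => ?_
    rw [blockOf_mul_inv_blockDiagPart_sub_one d hS, blockOf_mul_inv_blockDiagPart_sub_one d hS]
    by_cases h : m = n
    · simp [h]
    · simp [h, Ne.symm h, Matrix.mul_assoc]
  · intro m n
    rw [Matrix.mul_assoc, Matrix.trace_mul_comm, ← Matrix.mul_assoc]
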